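/- Assume moreover that k is algebraically closed. Let G ∈ M_n(k) be a matrix with entries in k, with eigenvalues a_1, …, a_N ∈ k, and let ∇ be the bounded k-linear operator on the k-Banach space k((S))ⁿ (with the max norm) defined by ∇(v) = (d v_1, …, d v_n)ᵀ + G·v. Then the classical spectrum of ∇ in L_k(k((S))ⁿ) equals the union over i = 1, …, N of the translates a_i + (classical spectrum of d in L_k(k((S)))). -/

import Mathlib

noncomputable section
open scoped Classical

/-- The operator `d = S·d/dS` on `k((S))`. -/
def dOp {k : Type*} [Field k] (f : LaurentSeries k) : LaurentSeries k :=
  ⟨fun i => (i : k) * f.coeff i,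
    f.isPWO_support'.mono fun i hi => by
      simp only [Function.mem_support, ne_eq] at hi ⊢
      intro h
      exact hi (by rw [h, mul_zero])⟩

/-- The `S`-adic absolute value on `k((S))` with `|S| = r` (and `k` trivially valued). -/
def lnorm {k : Type*} [Field k] (r : ℝ) (f : LaurentSeries k) : ℝ :=
  if f = 0 then 0 else r ^ f.order

/-- The max norm on `k((S))ⁿ`. -/
def vnorm {k : Type*} [Field k] (r : ℝ) {n : ℕ} (v : Fin n → LaurentSeries k) : ℝ :=
  sSup (Set.range fun i => lnorm r (v i))

/-- Invertibility in the algebra `L_k(k((S)))` of bounded `k`-linear operators. -/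
def InvertibleOp {k : Type*} [Field k] (r : ℝ)
    (φ : LaurentSeries k → LaurentSeries k) : Prop :=
  ∃ ψ : LaurentSeries k → LaurentSeries k, IsLinearMap k ψ ∧
    (∃ C : ℝ, ∀ f, lnorm r (ψ f) ≤ C * lnorm r f) ∧
    (∀ f, ψ (φ f) = f) ∧ (∀ f, φ (ψ f) = f)

/-- Invertibility in the algebra `L_k(k((S))ⁿ)` of bounded `k`-linear operators
(for the max norm on `k((S))ⁿ`). -/
def InvertibleOpV {k : Type*} [Field k] (r : ℝ) {n : ℕ}
    (φ : (Fin n → LaurentSeries k) → (Fin n → LaurentSeries k)) : Prop :=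
  ∃ ψ : (Fin n → LaurentSeries k) → (Fin n → LaurentSeries k), IsLinearMap k ψ ∧
    (∃ C : ℝ, ∀ v, vnorm r (ψ v) ≤ C * vnorm r v) ∧
    (∀ v, ψ (φ v) = v) ∧ (∀ v, φ (ψ v) = v)

/-- The `k`-linear operator on `k((S))` multiplying the coefficient of `S^m` by `c m`. -/
def diagOp {k : Type*} [Field k] (c : ℤ → k) (f : LaurentSeries k) : LaurentSeries k :=
  ⟨fun m => c m * f.coeff m,
    f.isPWO_support'.mono fun m hm => by
      simp only [Function.mem_support, ne_eq] at hm ⊢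
      intro h
      exact hm (by rw [h, mul_zero])⟩

@[simp]
theorem coeff_diagOp {k : Type*} [Field k] (c : ℤ → k) (f : LaurentSeries k) (m : ℤ) :
    (diagOp c f).coeff m = c m * f.coeff m := rfl

@[simp]
theorem coeff_dOp {k : Type*} [Field k] (f : LaurentSeries k) (m : ℤ) :
    (dOp f).coeff m = m * f.coeff m := rfl

theorem isLinearMap_diagOp {k : Type*} [Field k] (c : ℤ → k) :
    IsLinearMap k (diagOp c) where
  map_add f g := by ext m; simp [mul_add]
  map_smul b f := by ext m; simp [mul_left_comm]

theorem lnorm_nonneg {k : Type*} [Field k] {r : ℝ} (hr0 : 0 < r) (f : LaurentSeries k) :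
    0 ≤ lnorm r f := by
  unfold lnorm
  split_ifs
  · exact le_rfl
  · exact (zpow_pos hr0 _).le

theorem zpow_le_lnorm {k : Type*} [Field k] {r : ℝ} (hr0 : 0 < r) (hr1 : r < 1)
    {f : LaurentSeries k} {m : ℤ} (hm : f.coeff m ≠ 0) : r ^ m ≤ lnorm r f := by
  have hf : f ≠ 0 := by
    rintro rfl
    exact hm rfl
  rw [lnorm, if_neg hf]
  exact zpow_le_zpow_right_of_le_one₀ hr0 hr1.le (HahnSeries.order_le_of_coeff_ne_zero hm)

theorem lnorm_le_of_forall_coeff_ne_zero {k : Type*} [Field k] {r : ℝ} {f : LaurentSeries k}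
    {B : ℝ} (hB : 0 ≤ B) (h : ∀ m : ℤ, f.coeff m ≠ 0 → r ^ m ≤ B) : lnorm r f ≤ B := by
  unfold lnorm
  split_ifs with hf
  · exact hB
  · exact h _ (mt HahnSeries.coeff_order_eq_zero.mp hf)

theorem lnorm_le_vnorm {k : Type*} [Field k] (r : ℝ) {n : ℕ} (v : Fin n → LaurentSeries k)
    (j : Fin n) : lnorm r (v j) ≤ vnorm r v :=
  le_csSup (Set.finite_range _).bddAbove ⟨j, rfl⟩

theorem vnorm_nonneg {k : Type*} [Field k] {r : ℝ} (hr0 : 0 < r) {n : ℕ}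
    (v : Fin n → LaurentSeries k) : 0 ≤ vnorm r v := by
  apply Real.sSup_nonneg
  rintro _ ⟨i, rfl⟩
  exact lnorm_nonneg hr0 _

/-- The operator on `k((S))ⁿ` acting on the coefficients of `S^m` by the matrix `M m`. -/
def matOp {k : Type*} [Field k] {n : ℕ} (M : ℤ → Matrix (Fin n) (Fin n) k)
    (v : Fin n → LaurentSeries k) (i : Fin n) : LaurentSeries k :=
  ∑ j, diagOp (fun m => M m i j) (v j)

theorem coeff_matOp {k : Type*} [Field k] {n : ℕ} (M : ℤ → Matrix (Fin n) (Fin n) k)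
    (v : Fin n → LaurentSeries k) (i : Fin n) (m : ℤ) :
    (matOp M v i).coeff m = (M m).mulVec (fun j => (v j).coeff m) i := by
  simp [matOp, Matrix.mulVec, dotProduct, HahnSeries.coeff_sum]

theorem isLinearMap_matOp {k : Type*} [Field k] {n : ℕ} (M : ℤ → Matrix (Fin n) (Fin n) k) :
    IsLinearMap k (matOp M) where
  map_add v w := by
    ext i : 1
    simp [matOp, (isLinearMap_diagOp _).map_add, Finset.sum_add_distrib]
  map_smul b v := by
    ext i : 1
    simp [matOp, (isLinearMap_diagOp _).map_smul, Finset.smul_sum]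

theorem vnorm_matOp_le {k : Type*} [Field k] {r : ℝ} (hr0 : 0 < r) (hr1 : r < 1) {n : ℕ}
    (M : ℤ → Matrix (Fin n) (Fin n) k) (v : Fin n → LaurentSeries k) :
    vnorm r (matOp M v) ≤ vnorm r v := by
  apply Real.sSup_le _ (vnorm_nonneg hr0 v)
  rintro _ ⟨i, rfl⟩
  apply lnorm_le_of_forall_coeff_ne_zero (vnorm_nonneg hr0 v)
  intro m hm
  rw [coeff_matOp, Matrix.mulVec, dotProduct] at hm
  obtain ⟨j, -, hj⟩ := Finset.exists_ne_zero_of_sum_ne_zero hm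
  exact (zpow_le_lnorm hr0 hr1 (right_ne_zero_of_mul hj)).trans (lnorm_le_vnorm r v j)

/-- The operator `d - b` is invertible exactly when `b` is not an integer. -/
theorem invertibleOp_dOp_sub_iff {k : Type*} [Field k] {r : ℝ} (hr0 : 0 < r) (hr1 : r < 1)
    (b : k) : InvertibleOp r (fun g : LaurentSeries k => dOp g - b • g) ↔
      ∀ m : ℤ, (m : k) ≠ b := by
  constructor
  · rintro ⟨ψ, hψ, -, hl, -⟩ m rfl
    have h := hl (HahnSeries.single m 1)
    have h0 : dOp (HahnSeries.single m (1 : k)) - (m : k) • HahnSeries.single m 1 = 0 := by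
      ext i
      by_cases hi : i = m <;> simp [hi, HahnSeries.coeff_single_of_ne]
    beta_reduce at h
    rw [h0, hψ.map_zero] at h
    exact HahnSeries.single_ne_zero one_ne_zero h.symm
  · intro hb
    have hb' (m : ℤ) : (m : k) - b ≠ 0 := sub_ne_zero.mpr (hb m)
    refine ⟨diagOp fun m => ((m : k) - b)⁻¹, isLinearMap_diagOp _, ⟨1, fun f => ?_⟩,
      fun f => ?_, fun f => ?_⟩
    · rw [one_mul]
      refine lnorm_le_of_forall_coeff_ne_zero (lnorm_nonneg hr0 f) fun m hm => ?_
      exact zpow_le_lnorm hr0 hr1 (right_ne_zero_of_mul hm)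
    · ext m
      simp only [coeff_diagOp, HahnSeries.coeff_sub, coeff_dOp, HahnSeries.coeff_smul,
        smul_eq_mul, ← sub_mul]
      exact inv_mul_cancel_left₀ (hb' m) _
    · ext m
      simp only [coeff_diagOp, HahnSeries.coeff_sub, coeff_dOp, HahnSeries.coeff_smul,
        smul_eq_mul, ← sub_mul]
      exact mul_inv_cancel_left₀ (hb' m) _

/-- On coefficients of `S^m`, the operator `d + G - c` acts as `G - (c - m)`. -/
theorem coeff_connection {k : Type*} [Field k] {n : ℕ} (G : Matrix (Fin n) (Fin n) k) (c : k)
    (v : Fin n → LaurentSeries k) (i : Fin n) (m : ℤ) :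
    (dOp (v i) + (∑ j, G i j • v j) - c • v i).coeff m =
      (G - algebraMap k _ (c - m)).mulVec (fun j => (v j).coeff m) i := by
  simp only [HahnSeries.coeff_sub, HahnSeries.coeff_add, coeff_dOp, HahnSeries.coeff_sum,
    HahnSeries.coeff_smul, smul_eq_mul, Matrix.sub_mulVec, Pi.sub_apply,
    Algebra.algebraMap_eq_smul_one, Matrix.smul_mulVec, Matrix.one_mulVec, Pi.smul_apply]
  simp only [Matrix.mulVec, dotProduct]
  ring

/-- The operator `d + G - c` on `k((S))ⁿ` is invertible exactly when no `c - m`, for `m` an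
integer, is an eigenvalue of `G`. -/
theorem invertibleOpV_connection_iff {k : Type*} [Field k] {r : ℝ} (hr0 : 0 < r) (hr1 : r < 1)
    {n : ℕ} (G : Matrix (Fin n) (Fin n) k) (c : k) :
    InvertibleOpV r (fun v : Fin n → LaurentSeries k =>
        fun i => dOp (v i) + (∑ j, G i j • v j) - c • v i) ↔
      ∀ m : ℤ, ¬ Module.End.HasEigenvalue (Matrix.toLin' G) (c - m) := by
  constructor
  · rintro ⟨ψ, hψ, -, hl, -⟩ m hm
    obtain ⟨u, hu⟩ := hm.exists_hasEigenvector
    have hGu : G.mulVec u = (c - m) • u := by simpa using hu.apply_eq_smul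
    have h := hl fun j => HahnSeries.single m (u j)
    have h0 : (fun i => dOp (HahnSeries.single m (u i)) +
        (∑ j, G i j • HahnSeries.single m (u j)) - c • HahnSeries.single m (u i)) = 0 := by
      ext i l
      refine (coeff_connection G c (fun j => HahnSeries.single m (u j)) i l).trans ?_
      by_cases hl : l = m
      · subst hl
        simp [Matrix.sub_mulVec, Algebra.algebraMap_eq_smul_one, Matrix.smul_mulVec, hGu]
      · simp only [HahnSeries.coeff_single_of_ne hl]
        exact congrFun (Matrix.mulVec_zero _) i
    beta_reduce at h
    rw [h0, hψ.map_zero] at h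
    exact hu.2 (funext fun i => HahnSeries.single_eq_zero_iff.mp (congrFun h i).symm)
  · intro hc
    have hunit (m : ℤ) : IsUnit (G - algebraMap k _ (c - m)).det := by
      have h := hc m
      rw [Module.End.hasEigenvalue_iff_mem_spectrum, Matrix.spectrum_toLin',
        spectrum.notMem_iff, ← IsUnit.neg_iff, neg_sub] at h
      exact (Matrix.isUnit_iff_isUnit_det _).mp h
    refine ⟨matOp fun m => (G - algebraMap k _ (c - m))⁻¹, isLinearMap_matOp _,
      ⟨1, fun v => ?_⟩, fun v => ?_, fun v => ?_⟩
    · rw [one_mul]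
      exact vnorm_matOp_le hr0 hr1 _ v
    · ext i m
      rw [coeff_matOp]
      simp only [coeff_connection]
      rw [Matrix.mulVec_mulVec, Matrix.nonsing_inv_mul _ (hunit m), Matrix.one_mulVec]
    · ext i m
      rw [coeff_connection]
      simp only [coeff_matOp]
      rw [Matrix.mulVec_mulVec, Matrix.mul_nonsing_inv _ (hunit m), Matrix.one_mulVec]

/-- `k` algebraically closed, `G ∈ M_n(k)` with eigenvalues `a₁,…,a_N`,
and `∇ v = (d v₁, …, d vₙ)ᵀ + G·v` on `k((S))ⁿ`.  The classical spectrum of `∇` in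
`L_k(k((S))ⁿ)` is the union of the translates `aᵢ + (classical spectrum of d)`. -/
theorem classical_spectrum_regular_singular_connection
    {k : Type*} [Field k] [CharZero k] [IsAlgClosed k]
    (r : ℝ) (hr0 : 0 < r) (hr1 : r < 1)
    (n N : ℕ) (G : Matrix (Fin n) (Fin n) k) (a : Fin N → k)
    (hEig : ∀ c : k, (∃ i, a i = c) ↔ Module.End.HasEigenvalue (Matrix.toLin' G) c) :
    {c : k | ¬ InvertibleOpV r (fun v : Fin n → LaurentSeries k =>
        fun i => dOp (v i) + (∑ j, G i j • v j) - c • v i)}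
      = ⋃ i : Fin N, (fun b => a i + b) ''
          {b : k | ¬ InvertibleOp r (fun g : LaurentSeries k => dOp g - b • g)} := by
  ext c
  simp only [Set.mem_ofPred_eq, Set.mem_iUnion, Set.mem_image,
    invertibleOpV_connection_iff hr0 hr1, invertibleOp_dOp_sub_iff hr0 hr1]
  push Not
  simp only [← hEig]
  constructor
  · rintro ⟨m, i, hi⟩
    exact ⟨i, m, ⟨m, rfl⟩, by rw [hi, sub_add_cancel]⟩
  · rintro ⟨i, _, ⟨m, rfl⟩, rfl⟩
    exact ⟨m, i, (add_sub_cancel_right _ _).symm⟩
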